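/- Fix n, k ≥ 20. Consider the mechanism M that, given input s ∈ X^n (or s ∈ X^{n−1}) and k adaptively chosen statistical queries ψ_1, …, ψ_k : X → [0,1], answers each query ψ_j by sampling from N(μ_j, max{σ_j²/t, 1/T}) where μ_j is the empirical mean of ψ_j on the input and σ_j² the empirical variance, with parameters T ≤ min{t², t·n/10}. Then, for any interactive adversary A choosing the queries, the map taking s to the transcript of the interaction between A and M is (k·t/n²)-ALKL stable. -/

import Mathlib

open MeasureTheory ProbabilityTheory
open scoped BigOperators ENNReal

/-- Kullback–Leibler divergence between two measures, as the integral of the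
log-likelihood ratio. -/
noncomputable def klDiv {Ω : Type*} [MeasurableSpace Ω] (μ ν : Measure Ω) : ℝ :=
  ∫ x, llr μ ν x ∂μ

/-- Empirical mean `μ = (1/m) Σ_i ψ(s_i)` of a query on a dataset of size `m`. -/
noncomputable def empMean {X : Type*} {m : ℕ} (ψ : X → ℝ) (s : Fin m → X) : ℝ :=
  (∑ i : Fin m, ψ (s i)) / m

/-- Empirical variance `σ² = (1/m) Σ_i (ψ(s_i) − μ)²` of a query on a dataset of size `m`. -/
noncomputable def empVar {X : Type*} {m : ℕ} (ψ : X → ℝ) (s : Fin m → X) : ℝ :=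
  (∑ i : Fin m, (ψ (s i) - empMean ψ s) ^ 2) / m

/-- Density of the Gaussian distribution `N(m, v)` at `x`. -/
noncomputable def gpdf (m v x : ℝ) : ℝ :=
  (Real.sqrt (2 * Real.pi * v))⁻¹ * Real.exp (-(x - m) ^ 2 / (2 * v))

/-- The answers received in rounds `1, …, j−1`, extracted from the full answer vector. -/
def prevAnswers {k : ℕ} (v : Fin k → ℝ) (j : Fin k) : Fin (j : ℕ) → ℝ :=
  fun i => v ⟨i.1, i.2.trans j.2⟩

/-- The distribution on the vector of `k` answers produced by the variance-calibrated
Gaussian mechanism with parameters `t, T` on dataset `s`, interacting with the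
(deterministic, given its seed `ω`) adversary `A`: each answer `v_j` is the empirical mean
of the query `ψ_j = A ω j (v_1, …, v_{j−1})` plus Gaussian noise of variance
`max{σ_j²/t, 1/T}`.  The joint distribution is given by its density with respect to
Lebesgue measure on `ℝ^k`. -/
noncomputable def ansM {X Ω : Type*} {k m : ℕ} (t T : ℝ)
    (A : Ω → (j : Fin k) → (Fin (j : ℕ) → ℝ) → X → ℝ) (ω : Ω) (s : Fin m → X) :
    Measure (Fin k → ℝ) :=
  (Measure.pi fun _ : Fin k => (volume : Measure ℝ)).withDensity fun v =>
    ∏ j : Fin k,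
      ENNReal.ofReal
        (gpdf (empMean (A ω j (prevAnswers v j)) s)
          (max (empVar (A ω j (prevAnswers v j)) s / t) (1 / T)) (v j))

/-- The distribution of the transcript `(ψ_1, …, ψ_k, v_1, …, v_k)` of the interaction
between the mechanism (on dataset `s`, with parameters `t, T`) and a randomized adversary
with seed distribution `ρ` and next-query function `A`. -/
noncomputable def transcript {X Ω : Type*} [MeasurableSpace Ω] {k m : ℕ} (t T : ℝ)
    (ρ : Measure Ω) (A : Ω → (j : Fin k) → (Fin (j : ℕ) → ℝ) → X → ℝ)
    (s : Fin m → X) : Measure ((Fin k → (X → ℝ)) × (Fin k → ℝ)) :=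
  ρ.bind fun ω =>
    (ansM t T A ω s).map fun v => (fun j => A ω j (prevAnswers v j), v)

lemma div_sub_one_add_log_le {V W : ℝ} (hV : 0 < V) (hW : 0 < W) (h : V ≤ 1.1 * W) :
    V / W - 1 + Real.log (W / V) ≤ 0.605 * ((V - W) ^ 2 / V ^ 2) := by
  rcases le_total W V with hWV | hVW
  · have h1 := Real.le_log_one_add_of_nonneg (x := V / W - 1)
      (by rw [sub_nonneg, one_le_div hW]; exact hWV)
    have h2 : Real.log (W / V) = - Real.log (1 + (V / W - 1)) := by
      rw [← Real.log_inv]; congr 1; field_simp; ring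
    have h3 : 2 * (V / W - 1) / (V / W - 1 + 2) = 2 * (V - W) / (V + W) := by
      have : V / W - 1 + 2 = (V + W) / W := by field_simp; ring
      rw [this]; field_simp
    rw [h3] at h1
    have h4 : V / W - 1 - 2 * (V - W) / (V + W) = (V - W) ^ 2 / (W * (V + W)) := by
      field_simp; ring
    have h5 : (V - W) ^ 2 / (W * (V + W)) ≤ 0.605 * ((V - W) ^ 2 / V ^ 2) := by
      rw [← mul_div_assoc, div_le_div_iff₀ (by positivity) (by positivity)]
      have : V ^ 2 ≤ 0.605 * (W * (V + W)) := by nlinarith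
      nlinarith [mul_le_mul_of_nonneg_left this (sq_nonneg (V - W))]
    linarith
  · have h1 : Real.log (W / V) ≤ Real.sinh (Real.log (W / V)) :=
      Real.self_le_sinh_iff.2 (Real.log_nonneg ((one_le_div hV).2 hVW))
    rw [Real.sinh_log (by positivity), inv_div] at h1
    have h4 : V / W - 1 + (W / V - V / W) / 2 = (V - W) ^ 2 / (2 * (V * W)) := by
      field_simp; ring
    have h5 : (V - W) ^ 2 / (2 * (V * W)) ≤ 0.605 * ((V - W) ^ 2 / V ^ 2) := by
      rw [← mul_div_assoc, div_le_div_iff₀ (by positivity) (by positivity)]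
      have : V ^ 2 ≤ 0.605 * (2 * (V * W)) := by nlinarith
      nlinarith [mul_le_mul_of_nonneg_left this (sq_nonneg (V - W))]
    linarith

lemma empMean_removeNth {X : Type*} {n : ℕ} (hn : 0 < n) (ψ : X → ℝ) (s : Fin (n + 1) → X)
    (i : Fin (n + 1)) :
    empMean ψ (i.removeNth s) = empMean ψ s - (ψ (s i) - empMean ψ s) / n := by
  have hn' : (n : ℝ) ≠ 0 := by positivity
  have hN : (n : ℝ) + 1 ≠ 0 := by positivity
  simp only [empMean, Fin.sum_univ_succAbove _ i, Fin.removeNth, Nat.cast_add, Nat.cast_one]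
  field_simp
  ring

lemma sum_sub_empMean {X : Type*} {m : ℕ} (hm : 0 < m) (ψ : X → ℝ) (s : Fin m → X) :
    ∑ i, (ψ (s i) - empMean ψ s) = 0 := by
  have hm' : (m : ℝ) ≠ 0 := by positivity
  simp [Finset.sum_sub_distrib, empMean]
  field_simp
  ring

lemma sum_sub_empMean_sq {X : Type*} {m : ℕ} (hm : 0 < m) (ψ : X → ℝ) (s : Fin m → X) :
    ∑ i, (ψ (s i) - empMean ψ s) ^ 2 = m * empVar ψ s := by
  have hm' : (m : ℝ) ≠ 0 := by positivity
  rw [empVar]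
  field_simp

lemma empVar_removeNth {X : Type*} {n : ℕ} (hn : 0 < n) (ψ : X → ℝ) (s : Fin (n + 1) → X)
    (i : Fin (n + 1)) :
    empVar ψ (i.removeNth s) =
      (n + 1) / n * (empVar ψ s - (ψ (s i) - empMean ψ s) ^ 2 / n) := by
  have hn' : (n : ℝ) ≠ 0 := by positivity
  have h1 := sum_sub_empMean n.succ_pos ψ s
  have h2 := sum_sub_empMean_sq n.succ_pos ψ s
  rw [Fin.sum_univ_succAbove _ i] at h1 h2
  rw [empVar, empMean_removeNth hn]
  have h3 : ∀ j : Fin n, (ψ (i.removeNth s j) -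
      (empMean ψ s - (ψ (s i) - empMean ψ s) / n)) ^ 2 =
      (ψ (s (i.succAbove j)) - empMean ψ s) ^ 2 +
      2 * ((ψ (s i) - empMean ψ s) / n) * (ψ (s (i.succAbove j)) - empMean ψ s) +
      ((ψ (s i) - empMean ψ s) / n) ^ 2 := fun j => by rw [Fin.removeNth]; ring
  simp_rw [h3, Finset.sum_add_distrib, ← Finset.mul_sum]
  rw [← eq_sub_iff_add_eq'] at h1 h2
  rw [h1, h2]
  simp only [Finset.sum_const, Finset.card_univ, Fintype.card_fin, nsmul_eq_mul]
  push_cast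
  field_simp
  ring

lemma empMean_mem_Icc {X : Type*} {m : ℕ} {ψ : X → ℝ} (hψ : ∀ x, ψ x ∈ Set.Icc (0 : ℝ) 1)
    (s : Fin m → X) : empMean ψ s ∈ Set.Icc (0 : ℝ) 1 := by
  refine ⟨div_nonneg (Finset.sum_nonneg fun i _ => (hψ _).1) (by positivity), ?_⟩
  refine div_le_one_of_le₀ ?_ (by positivity)
  simpa using Finset.sum_le_sum fun (i : Fin m) (_ : i ∈ Finset.univ) => (hψ (s i)).2

lemma empVar_nonneg {X : Type*} {m : ℕ} (ψ : X → ℝ) (s : Fin m → X) : 0 ≤ empVar ψ s :=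
  div_nonneg (Finset.sum_nonneg fun _ _ => sq_nonneg _) (by positivity)

lemma sq_sub_empMean_le_one {X : Type*} {m : ℕ} {ψ : X → ℝ}
    (hψ : ∀ x, ψ x ∈ Set.Icc (0 : ℝ) 1) (s : Fin m → X) (i : Fin m) :
    (ψ (s i) - empMean ψ s) ^ 2 ≤ 1 := by
  have h1 := hψ (s i)
  have h2 := empMean_mem_Icc hψ s
  rw [sq_le_one_iff_abs_le_one, abs_le]
  constructor <;> linarith [h1.1, h1.2, h2.1, h2.2]

lemma empVar_le_one {X : Type*} {m : ℕ} {ψ : X → ℝ} (hψ : ∀ x, ψ x ∈ Set.Icc (0 : ℝ) 1)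
    (s : Fin m → X) : empVar ψ s ≤ 1 := by
  refine div_le_one_of_le₀ ?_ (by positivity)
  simpa using Finset.sum_le_sum fun (i : Fin m) (_ : i ∈ Finset.univ) =>
    sq_sub_empMean_le_one hψ s i

/-- The variance of the noise added to the answer of the query `ψ` on the dataset `s`. -/
noncomputable def noiseVar {X : Type*} {m : ℕ} (t T : ℝ) (ψ : X → ℝ) (s : Fin m → X) : ℝ :=
  max (empVar ψ s / t) (1 / T)

lemma noiseVar_pos {X : Type*} {m : ℕ} {t T : ℝ} (hT : 0 < T) (ψ : X → ℝ) (s : Fin m → X) :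
    0 < noiseVar t T ψ s := lt_max_of_lt_right (by positivity)

/-- The Kullback–Leibler divergence from `N(m, v)` to `N(m', v')`. -/
noncomputable def gaussKL (m v m' v' : ℝ) : ℝ :=
  (v / v' - 1 + Real.log (v' / v) + (m - m') ^ 2 / v') / 2

lemma noiseVar_le_removeNth {X : Type*} {n : ℕ} (hn : 20 ≤ n + 1) {t T : ℝ} (ht : 0 < t)
    (hT : 0 < T) (hTn : T ≤ t * (n + 1) / 10) {ψ : X → ℝ}
    (hψ : ∀ x, ψ x ∈ Set.Icc (0 : ℝ) 1) (s : Fin (n + 1) → X) (i : Fin (n + 1)) :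
    noiseVar t T ψ s ≤ 1.1 * noiseVar t T ψ (i.removeNth s) := by
  have hn0 : 0 < n := by omega
  have hn' : (19 : ℝ) ≤ n := by exact_mod_cast (by omega : 19 ≤ n)
  have hr0 : 0 < (n : ℝ) := by positivity
  have hpos := noiseVar_pos (t := t) hT ψ (i.removeNth s)
  have h1 : 1 / T ≤ noiseVar t T ψ (i.removeNth s) := le_max_right _ _
  have h2 : empVar ψ (i.removeNth s) / t ≤ noiseVar t T ψ (i.removeNth s) := le_max_left _ _
  refine max_le ?_ (by linarith)
  have hd := sq_sub_empMean_le_one hψ s i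
  have h3 : empVar ψ s = n / (n + 1) * empVar ψ (i.removeNth s) +
      (ψ (s i) - empMean ψ s) ^ 2 / n := by
    rw [empVar_removeNth hn0]; field_simp; ring
  set U := noiseVar t T ψ (i.removeNth s)
  have h4 : 1 ≤ U * (t * (n + 1) / 10) := by
    rw [div_le_iff₀ hT] at h1
    nlinarith
  rw [div_le_iff₀ ht] at h2 ⊢
  have h5 : n / (n + 1) * empVar ψ (i.removeNth s) ≤ n / (n + 1) * (U * t) := by gcongr
  have h6 : (ψ (s i) - empMean ψ s) ^ 2 / n ≤ U * (t * (n + 1) / 10) / n := by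
    gcongr; linarith
  have h7 : n / (n + 1) * (U * t) + U * (t * (n + 1) / 10) / n ≤ 1.1 * U * t := by
    have : n / (n + 1) * (U * t) + U * (t * (n + 1) / 10) / n =
      (n / (n + 1) + (n + 1) / (10 * n)) * (U * t) := by field_simp
    rw [this, mul_assoc]
    have h8 : (n : ℝ) / (n + 1) + (n + 1) / (10 * n) ≤ 1.1 := by
      rw [div_add_div _ _ (by positivity) (by positivity), div_le_iff₀ (by positivity)]
      nlinarith
    gcongr
  linarith

lemma sum_gaussKL_removeNth_le {X : Type*} {n : ℕ} (hn : 20 ≤ n + 1) {t T : ℝ} (ht : 0 < t)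
    (hT : 0 < T) (hTt : T ≤ t ^ 2) (hTn : T ≤ t * (n + 1) / 10) {ψ : X → ℝ}
    (hψ : ∀ x, ψ x ∈ Set.Icc (0 : ℝ) 1) (s : Fin (n + 1) → X) :
    ∑ i : Fin (n + 1), gaussKL (empMean ψ s) (noiseVar t T ψ s)
      (empMean ψ (i.removeNth s)) (noiseVar t T ψ (i.removeNth s)) ≤ t / (n + 1) := by
  have hn0 : 0 < n := by omega
  have hn' : (19 : ℝ) ≤ n := by exact_mod_cast (by omega : 19 ≤ n)
  have hr0 : 0 < (n : ℝ) := by positivity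
  set V := noiseVar t T ψ s with hV
  set W := empVar ψ s with hW
  have hVpos : 0 < V := noiseVar_pos hT ψ s
  have hW0 : 0 ≤ W := empVar_nonneg ψ s
  have hWV : W ≤ V * t := by
    rw [← div_le_iff₀ ht]; exact le_max_left _ _
  have hVt : 1 ≤ V * t ^ 2 := by
    have : 1 / T ≤ V := le_max_right _ _
    rw [div_le_iff₀ hT] at this
    nlinarith
  set d : Fin (n + 1) → ℝ := fun i => ψ (s i) - empMean ψ s with hd
  have hd2 : ∑ i, d i ^ 2 = (n + 1) * W := by
    have := sum_sub_empMean_sq n.succ_pos ψ s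
    push_cast at this
    exact this
  have key : ∀ i, gaussKL (empMean ψ s) V (empMean ψ (i.removeNth s))
      (noiseVar t T ψ (i.removeNth s)) ≤
      0.3025 * ((W / n - d i ^ 2 * (n + 1) / n ^ 2) ^ 2 / (t ^ 2 * V ^ 2)) +
        0.55 * (d i ^ 2 / (n ^ 2 * V)) := by
    intro i
    set U := noiseVar t T ψ (i.removeNth s) with hU
    have hUpos : 0 < U := noiseVar_pos hT ψ _
    have hVU : V ≤ 1.1 * U := noiseVar_le_removeNth hn ht hT hTn hψ s i
    have h1 := div_sub_one_add_log_le hVpos hUpos hVU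
    have h2 : (V - U) ^ 2 ≤ (W / n - d i ^ 2 * (n + 1) / n ^ 2) ^ 2 / t ^ 2 := by
      rw [← div_pow]
      refine sq_le_sq.2 ?_
      have h3 : |V - U| ≤ |W / t - empVar ψ (i.removeNth s) / t| := by
        have := abs_max_sub_max_le_abs (W / t) (empVar ψ (i.removeNth s) / t) (1 / T)
        exact this
      refine h3.trans_eq ?_
      rw [empVar_removeNth hn0, abs_sub_comm]
      congr 1
      field_simp
      ring
    have h3 : (empMean ψ s - empMean ψ (i.removeNth s)) ^ 2 / U ≤
        1.1 * (d i ^ 2 / (n ^ 2 * V)) := by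
      rw [empMean_removeNth hn0]
      have : (empMean ψ s - (empMean ψ s - (ψ (s i) - empMean ψ s) / n)) ^ 2 / U =
          d i ^ 2 / n ^ 2 * (1 / U) := by rw [hd]; field_simp; ring
      rw [this]
      have h4 : 1 / U ≤ 1.1 / V := by
        rw [div_le_div_iff₀ hUpos hVpos]; linarith
      calc d i ^ 2 / n ^ 2 * (1 / U) ≤ d i ^ 2 / n ^ 2 * (1.1 / V) := by gcongr
        _ = _ := by field_simp
    have h4 : (V - U) ^ 2 / V ^ 2 ≤
        (W / n - d i ^ 2 * (n + 1) / n ^ 2) ^ 2 / (t ^ 2 * V ^ 2) := by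
      rw [← div_div]; gcongr
    rw [gaussKL]
    linarith
  have hd4 : ∑ i, d i ^ 4 ≤ (n + 1) * W := by
    rw [← hd2]
    refine Finset.sum_le_sum fun i _ => ?_
    have : d i ^ 2 ≤ 1 := sq_sub_empMean_le_one hψ s i
    nlinarith [sq_nonneg (d i)]
  have hsq : ∑ i, (W / n - d i ^ 2 * (n + 1) / n ^ 2) ^ 2 ≤ (n + 1) ^ 3 * W / n ^ 4 := by
    have h1 : ∀ i, (W / n - d i ^ 2 * (n + 1) / n ^ 2) ^ 2 =
      W ^ 2 / n ^ 2 - 2 * W * (n + 1) / n ^ 3 * d i ^ 2 + (n + 1) ^ 2 / n ^ 4 * d i ^ 4 :=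
      fun i => by field_simp; ring
    simp_rw [h1, Finset.sum_add_distrib, Finset.sum_sub_distrib, ← Finset.mul_sum, hd2]
    simp only [Finset.sum_const, Finset.card_univ, Fintype.card_fin, nsmul_eq_mul]
    push_cast
    have h2 : ((n : ℝ) + 1) ^ 2 / n ^ 4 * ∑ i, d i ^ 4 ≤
      (n + 1) ^ 2 / n ^ 4 * ((n + 1) * W) := by gcongr
    have h3 : ((n : ℝ) + 1) * (W ^ 2 / n ^ 2) - 2 * W * (n + 1) / n ^ 3 * ((n + 1) * W) =
      - ((n + 1) * (n + 2) * W ^ 2 / n ^ 3) := by field_simp; ring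
    have h4 : 0 ≤ ((n : ℝ) + 1) * (n + 2) * W ^ 2 / n ^ 3 := by positivity
    have h5 : ((n : ℝ) + 1) ^ 2 / n ^ 4 * ((n + 1) * W) = (n + 1) ^ 3 * W / n ^ 4 := by
      field_simp
    linarith
  refine (Finset.sum_le_sum fun i _ => key i).trans ?_
  rw [Finset.sum_add_distrib, ← Finset.mul_sum, ← Finset.mul_sum, ← Finset.sum_div,
    ← Finset.sum_div, hd2]
  have e1 : (∑ i, (W / n - d i ^ 2 * (n + 1) / n ^ 2) ^ 2) / (t ^ 2 * V ^ 2) ≤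
      t * ((n + 1) ^ 3 / n ^ 4) := by
    calc _ ≤ (n + 1) ^ 3 * W / n ^ 4 / (t ^ 2 * V ^ 2) := by gcongr
      _ = W / (t ^ 2 * V ^ 2) * ((n + 1) ^ 3 / n ^ 4) := by field_simp
      _ ≤ _ := by
        gcongr
        rw [div_le_iff₀ (by positivity)]
        have : V * t * 1 ≤ V * t * (V * t ^ 2) := by gcongr
        nlinarith
  have e2 : (n + 1) * W / (n ^ 2 * V) ≤ t * ((n + 1) / n ^ 2) := by
    rw [← mul_div_assoc, div_le_div_iff₀ (by positivity) (by positivity)]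
    calc (n + 1) * W * (n : ℝ) ^ 2 ≤ (n + 1) * (V * t) * (n : ℝ) ^ 2 := by gcongr
      _ = _ := by ring
  have e3 : 0.3025 * (((n : ℝ) + 1) ^ 3 / n ^ 4) + 0.55 * (((n : ℝ) + 1) / n ^ 2) ≤
      1 / (n + 1) := by
    have hc : ((n : ℝ) + 1) / n ≤ 20 / 19 := by
      rw [div_le_div_iff₀ hr0 (by norm_num)]; linarith
    have hc0 : 0 ≤ ((n : ℝ) + 1) / n := by positivity
    have hc2 : (((n : ℝ) + 1) / n) ^ 2 ≤ (20 / 19) ^ 2 := by gcongr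
    have hc4 : (((n : ℝ) + 1) / n) ^ 4 ≤ (20 / 19) ^ 4 := by gcongr
    rw [le_div_iff₀ (by positivity)]
    have : (0.3025 * (((n : ℝ) + 1) ^ 3 / n ^ 4) + 0.55 * (((n : ℝ) + 1) / n ^ 2)) * (n + 1) =
      0.3025 * (((n : ℝ) + 1) / n) ^ 4 + 0.55 * (((n : ℝ) + 1) / n) ^ 2 := by
      field_simp
    rw [this]
    norm_num at hc2 hc4 ⊢
    linarith
  calc _ ≤ 0.3025 * (t * (((n : ℝ) + 1) ^ 3 / n ^ 4)) + 0.55 * (t * (((n : ℝ) + 1) / n ^ 2)) := by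
        gcongr
    _ = t * (0.3025 * (((n : ℝ) + 1) ^ 3 / n ^ 4) + 0.55 * (((n : ℝ) + 1) / n ^ 2)) := by ring
    _ ≤ t * (1 / (n + 1)) := by gcongr
    _ = _ := by ring

lemma gpdf_pos {v : ℝ} (hv : 0 < v) (m x : ℝ) : 0 < gpdf m v x := by
  unfold gpdf; positivity

lemma withDensity_gpdf {v : ℝ} (hv : 0 < v) (m : ℝ) :
    (volume : Measure ℝ).withDensity (fun x => ENNReal.ofReal (gpdf m v x)) =
      gaussianReal m v.toNNReal := by
  rw [gaussianReal_of_var_ne_zero _ (by simpa using hv)]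
  congr 1
  ext x
  simp [gaussianPDF, gaussianPDFReal, gpdf, Real.coe_toNNReal v hv.le]

lemma log_gpdf_div {v v' : ℝ} (hv : 0 < v) (hv' : 0 < v') (m m' x : ℝ) :
    Real.log (gpdf m v x / gpdf m' v' x) =
      Real.log (v' / v) / 2 - (x - m) ^ 2 / (2 * v) + (x - m') ^ 2 / (2 * v') := by
  have hpi := Real.pi_pos
  rw [Real.log_div (gpdf_pos hv m x).ne' (gpdf_pos hv' m' x).ne', gpdf, gpdf,
    Real.log_mul (by positivity) (by positivity), Real.log_mul (by positivity) (by positivity),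
    Real.log_exp, Real.log_exp, Real.log_inv, Real.log_inv, Real.log_sqrt (by positivity),
    Real.log_sqrt (by positivity), Real.log_mul (by positivity) hv.ne',
    Real.log_mul (by positivity) hv'.ne', Real.log_div hv'.ne' hv.ne']
  ring

lemma integrable_sq_sub_gaussianReal (m a : ℝ) (v : NNReal) :
    Integrable (fun x => (x - a) ^ 2) (gaussianReal m v) :=
  ((memLp_id_gaussianReal 2).sub (memLp_const a)).integrable_sq

lemma integral_sq_sub_gaussianReal (m a : ℝ) (v : NNReal) :
    ∫ x, (x - a) ^ 2 ∂(gaussianReal m v) = v + (m - a) ^ 2 := by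
  have h1 : ∫ x, (x - m) ^ 2 ∂(gaussianReal m v) = v := by
    have := variance_id_gaussianReal (μ := m) (v := v)
    rw [variance_eq_integral aemeasurable_id] at this
    simpa using this
  have hid : Integrable (fun x : ℝ => x) (gaussianReal m v) :=
    (memLp_id_gaussianReal 1).integrable le_rfl
  have h2 : ∀ x : ℝ, (x - a) ^ 2 = (x - m) ^ 2 + (2 * (m - a) * x + (a ^ 2 - m ^ 2)) :=
    fun x => by ring
  simp_rw [h2]
  have i1 : Integrable (fun x : ℝ => 2 * (m - a) * x) (gaussianReal m v) := hid.const_mul _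
  have i2 : Integrable (fun _ : ℝ => a ^ 2 - m ^ 2) (gaussianReal m v) := integrable_const _
  have i3 : Integrable (fun x : ℝ => 2 * (m - a) * x + (a ^ 2 - m ^ 2)) (gaussianReal m v) :=
    i1.add i2
  rw [integral_add (integrable_sq_sub_gaussianReal m m v) i3, integral_add i1 i2,
    integral_const_mul, h1, integral_id_gaussianReal]
  simp

lemma integral_log_gpdf_div {v v' : ℝ} (hv : 0 < v) (hv' : 0 < v') (m m' : ℝ) :
    Integrable (fun x => Real.log (gpdf m v x / gpdf m' v' x)) (gaussianReal m v.toNNReal) ∧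
    ∫ x, Real.log (gpdf m v x / gpdf m' v' x) ∂(gaussianReal m v.toNNReal) =
      gaussKL m v m' v' := by
  simp_rw [log_gpdf_div hv hv']
  have i1 := (integrable_sq_sub_gaussianReal m m v.toNNReal).div_const (2 * v)
  have i2 := (integrable_sq_sub_gaussianReal m m' v.toNNReal).div_const (2 * v')
  have i0 : Integrable (fun _ : ℝ => Real.log (v' / v) / 2) (gaussianReal m v.toNNReal) :=
    integrable_const _
  refine ⟨(i0.sub i1).add i2, ?_⟩
  have e1 : ∫ x, (Real.log (v' / v) / 2 - (x - m) ^ 2 / (2 * v) + (x - m') ^ 2 / (2 * v'))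
      ∂(gaussianReal m v.toNNReal) =
      ∫ x, (Real.log (v' / v) / 2 - (x - m) ^ 2 / (2 * v)) ∂(gaussianReal m v.toNNReal) +
      ∫ x, (x - m') ^ 2 / (2 * v') ∂(gaussianReal m v.toNNReal) := integral_add (i0.sub i1) i2
  rw [e1, integral_sub i0 i1, integral_const, integral_div, integral_div,
    integral_sq_sub_gaussianReal, integral_sq_sub_gaussianReal, Real.coe_toNNReal v hv.le, gaussKL]
  simp
  field_simp
  ring

lemma lintegral_enorm_log_gpdf_div_le {m m' v v' a b : ℝ} (hm : m ∈ Set.Icc (0 : ℝ) 1)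
    (hm' : m' ∈ Set.Icc (0 : ℝ) 1) (ha : 0 < a) (hv : v ∈ Set.Icc a b)
    (hv' : v' ∈ Set.Icc a b) :
    ∫⁻ x, ‖Real.log (gpdf m v x / gpdf m' v' x)‖ₑ ∂(gaussianReal m v.toNNReal) ≤
      ENNReal.ofReal (3 * (b + 1) / a) := by
  have hv0 : 0 < v := ha.trans_le hv.1
  have hv0' : 0 < v' := ha.trans_le hv'.1
  have hb : 0 < b := hv0.trans_le hv.2
  set L := |Real.log (v' / v)| / 2
  have i1 := (integrable_sq_sub_gaussianReal m m v.toNNReal).div_const (2 * a)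
  have i2 := (integrable_sq_sub_gaussianReal m m' v.toNNReal).div_const (2 * a)
  have i0 : Integrable (fun _ : ℝ => L) (gaussianReal m v.toNNReal) :=
    integrable_const _
  have hbd : ∀ x, ‖Real.log (gpdf m v x / gpdf m' v' x)‖ₑ ≤
      ENNReal.ofReal (L + (x - m) ^ 2 / (2 * a) + (x - m') ^ 2 / (2 * a)) := by
    intro x
    rw [Real.enorm_eq_ofReal_abs, log_gpdf_div hv0 hv0']
    refine ENNReal.ofReal_le_ofReal ?_
    refine (abs_add_le _ _).trans (add_le_add ((abs_sub _ _).trans (add_le_add ?_ ?_)) ?_)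
    · rw [abs_div, abs_two]
    · rw [abs_of_nonneg (by positivity)]
      have := hv.1
      gcongr
    · rw [abs_of_nonneg (by positivity)]
      have := hv'.1
      gcongr
  refine (lintegral_mono hbd).trans ?_
  have i3 : Integrable (fun x => L + (x - m) ^ 2 / (2 * a) + (x - m') ^ 2 / (2 * a))
      (gaussianReal m v.toNNReal) := (i0.add i1).add i2
  rw [← ofReal_integral_eq_lintegral_ofReal i3
    (Filter.Eventually.of_forall fun x => by positivity)]
  refine ENNReal.ofReal_le_ofReal ?_
  have e1 : ∫ x, (L + (x - m) ^ 2 / (2 * a) + (x - m') ^ 2 / (2 * a))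
      ∂(gaussianReal m v.toNNReal) =
      ∫ x, (L + (x - m) ^ 2 / (2 * a)) ∂(gaussianReal m v.toNNReal) +
      ∫ x, (x - m') ^ 2 / (2 * a) ∂(gaussianReal m v.toNNReal) := integral_add (i0.add i1) i2
  rw [e1, integral_add i0 i1, integral_const, integral_div, integral_div,
    integral_sq_sub_gaussianReal, integral_sq_sub_gaussianReal, Real.coe_toNNReal v hv0.le]
  have hlog : |Real.log (v' / v)| ≤ b / a := by
    have hr : ∀ {x y : ℝ}, x ∈ Set.Icc a b → y ∈ Set.Icc a b → Real.log (x / y) ≤ b / a := by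
      intro x y hx hy
      have hy0 := ha.trans_le hy.1
      have hx0 := ha.trans_le hx.1
      refine (Real.log_le_self (by positivity)).trans ?_
      exact div_le_div₀ hb.le hx.2 ha hy.1
    rw [abs_le]
    refine ⟨?_, hr hv' hv⟩
    rw [neg_le, ← Real.log_inv, inv_div]
    exact hr hv hv'
  have hmm : (m - m') ^ 2 ≤ 1 := by
    rw [sq_le_one_iff_abs_le_one, abs_le]
    constructor <;> linarith [hm.1, hm.2, hm'.1, hm'.2]
  simp only [probReal_univ, smul_eq_mul, one_mul, sub_self]
  have h1 : (v + 0 ^ 2) / (2 * a) ≤ b / (2 * a) := by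
    have := hv.2
    gcongr; simpa using this
  have h2 : (v + (m - m') ^ 2) / (2 * a) ≤ (b + 1) / (2 * a) := by
    have := hv.2
    gcongr
  have h3 : L ≤ b / a / 2 := by simp only [L]; gcongr
  have h4 : b / a / 2 + b / (2 * a) + (b + 1) / (2 * a) ≤ 3 * (b + 1) / a := by
    rw [div_div, mul_comm a 2, ← add_div, ← add_div, div_le_div_iff₀ (by positivity) ha]
    nlinarith
  linarith

/-- The law of a random vector whose `j`-th coordinate has conditional density `q j` given the
preceding ones. -/
noncomputable def chainMeasure {k : ℕ} (q : (j : Fin k) → (Fin (j : ℕ) → ℝ) → ℝ → ℝ≥0∞) :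
    Measure (Fin k → ℝ) :=
  (Measure.pi fun _ : Fin k => (volume : Measure ℝ)).withDensity fun v =>
    ∏ j : Fin k, q j (prevAnswers v j) (v j)

lemma measurable_prevAnswers {k : ℕ} (j : Fin k) :
    Measurable fun v : Fin k → ℝ => prevAnswers v j :=
  measurable_pi_lambda _ fun _ => measurable_pi_apply _

lemma measurable_comp_prevAnswers {k : ℕ} {β : Type*} [MeasurableSpace β] {j : Fin k}
    {f : (Fin (j : ℕ) → ℝ) → ℝ → β} (hf : Measurable (Function.uncurry f)) :
    Measurable fun v : Fin k → ℝ => f (prevAnswers v j) (v j) :=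
  hf.comp ((measurable_prevAnswers j).prodMk (measurable_pi_apply j))

lemma measurable_snoc {k : ℕ} :
    Measurable fun p : (Fin k → ℝ) × ℝ => (Fin.snoc p.1 p.2 : Fin (k + 1) → ℝ) := by
  refine measurable_pi_lambda _ fun i => ?_
  induction i using Fin.lastCases with
  | last => simpa using measurable_snd
  | cast i => simp only [Fin.snoc_castSucc]; exact (measurable_pi_apply i).comp measurable_fst

lemma prevAnswers_snoc_last {k : ℕ} (u : Fin k → ℝ) (x : ℝ) :
    prevAnswers (Fin.snoc u x : Fin (k + 1) → ℝ) (Fin.last k) = u := by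
  ext i
  exact Fin.snoc_castSucc (α := fun _ => ℝ) x u i

lemma prevAnswers_snoc_castSucc {k : ℕ} (u : Fin k → ℝ) (x : ℝ) (j : Fin k) :
    prevAnswers (Fin.snoc u x : Fin (k + 1) → ℝ) j.castSucc = prevAnswers u j := by
  ext i
  exact Fin.snoc_castSucc (α := fun _ => ℝ) x u ⟨i.1, i.2.trans j.2⟩

lemma lintegral_pi_snoc {k : ℕ} {G : (Fin (k + 1) → ℝ) → ℝ≥0∞} (hG : Measurable G) :
    ∫⁻ v, G v ∂(Measure.pi fun _ => (volume : Measure ℝ)) =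
      ∫⁻ u, ∫⁻ x, G (Fin.snoc u x) ∂(volume : Measure ℝ)
        ∂(Measure.pi fun _ : Fin k => (volume : Measure ℝ)) := by
  have h := (measurePreserving_piFinSuccAbove (n := k) (fun _ => (volume : Measure ℝ))
    (Fin.last k)).symm
  rw [← h.lintegral_comp hG, lintegral_prod_symm (fun z => G _)
    (hG.comp h.measurable).aemeasurable]
  exact lintegral_congr fun u => lintegral_congr fun x =>
    congrArg G (Fin.insertNth_last' (n := k) x u)

/-- The conditional law of the last coordinate under `chainMeasure`. -/
noncomputable def lastKernel {k : ℕ} (q : (Fin k → ℝ) → ℝ → ℝ≥0∞) : Kernel (Fin k → ℝ) ℝ :=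
  Kernel.withDensity (Kernel.const _ volume) q

lemma lastKernel_apply {k : ℕ} {q : (Fin k → ℝ) → ℝ → ℝ≥0∞}
    (hq : Measurable (Function.uncurry q)) (u : Fin k → ℝ) :
    lastKernel q u = volume.withDensity (q u) := by
  rw [lastKernel, Kernel.withDensity_apply _ hq, Kernel.const_apply]

lemma chainMeasure_succ {k : ℕ} {q : (j : Fin (k + 1)) → (Fin (j : ℕ) → ℝ) → ℝ → ℝ≥0∞}
    (hq : ∀ j, Measurable (Function.uncurry (q j)))
    [SFinite (chainMeasure fun j : Fin k => q j.castSucc)]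
    [IsSFiniteKernel (lastKernel (q (Fin.last k)))] :
    chainMeasure q = ((chainMeasure fun j : Fin k => q j.castSucc) ⊗ₘ
      lastKernel (q (Fin.last k))).map fun p => Fin.snoc p.1 p.2 := by
  have hd : Measurable fun v : Fin (k + 1) → ℝ => ∏ j, q j (prevAnswers v j) (v j) :=
    Finset.measurable_prod _ fun j _ => measurable_comp_prevAnswers (hq j)
  have hd' : Measurable fun v : Fin k → ℝ =>
      ∏ j : Fin k, q j.castSucc (prevAnswers v j) (v j) :=
    Finset.measurable_prod _ fun j _ => measurable_comp_prevAnswers (hq j.castSucc)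
  refine Measure.ext_of_lintegral _ fun G hG => ?_
  have hGs : Measurable fun p : (Fin k → ℝ) × ℝ => G (Fin.snoc p.1 p.2) :=
    hG.comp measurable_snoc
  rw [lintegral_map hG measurable_snoc, Measure.lintegral_compProd hGs, chainMeasure,
    lintegral_withDensity_eq_lintegral_mul _ hd hG, lintegral_pi_snoc (hd.mul hG), chainMeasure]
  have hin : ∀ u : Fin k → ℝ, ∫⁻ x, G (Fin.snoc u x) ∂(lastKernel (q (Fin.last k)) u) =
      ∫⁻ x, q (Fin.last k) u x * G (Fin.snoc u x) := fun u => by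
    have hqu : Measurable (q (Fin.last k) u) :=
      (hq (Fin.last k)).comp (measurable_prodMk_left (x := u))
    have hGu : Measurable fun x => G (Fin.snoc u x) :=
      hGs.comp (measurable_prodMk_left (x := u))
    rw [lastKernel_apply (hq _), lintegral_withDensity_eq_lintegral_mul _ hqu hGu]
    rfl
  rw [lintegral_withDensity_eq_lintegral_mul _ hd' hGs.lintegral_kernel_prod_right']
  refine lintegral_congr fun u => ?_
  simp only [Pi.mul_apply, hin]
  rw [← lintegral_const_mul]
  · refine lintegral_congr fun x => ?_
    rw [Fin.prod_univ_castSucc, mul_assoc]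
    simp only [prevAnswers_snoc_castSucc, Fin.snoc_castSucc]
    congr 2
    rw [Fin.snoc_last]
    exact congrArg (fun w => q (Fin.last k) w x) (prevAnswers_snoc_last u x)
  · exact ((hq (Fin.last k)).comp measurable_prodMk_left).mul (hGs.comp measurable_prodMk_left)

lemma isProbabilityMeasure_chainMeasure {k : ℕ}
    {q : (j : Fin k) → (Fin (j : ℕ) → ℝ) → ℝ → ℝ≥0∞}
    (hq : ∀ j, Measurable (Function.uncurry (q j)))
    (hq1 : ∀ j p, IsProbabilityMeasure ((volume : Measure ℝ).withDensity (q j p))) :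
    IsProbabilityMeasure (chainMeasure q) := by
  induction k with
  | zero =>
    constructor
    simp [chainMeasure]
  | succ k ih =>
    have : IsProbabilityMeasure (chainMeasure fun j : Fin k => q j.castSucc) :=
      ih (fun j => hq j.castSucc) fun j => hq1 j.castSucc
    have : IsMarkovKernel (lastKernel (q (Fin.last k))) :=
      ⟨fun u => by rw [lastKernel_apply (hq _)]; exact hq1 (Fin.last k) u⟩
    rw [chainMeasure_succ hq]
    exact Measure.isProbabilityMeasure_map measurable_snoc.aemeasurable

lemma chainMeasure_sum_bounds {k : ℕ}
    {q : (j : Fin k) → (Fin (j : ℕ) → ℝ) → ℝ → ℝ≥0∞}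
    (hq : ∀ j, Measurable (Function.uncurry (q j)))
    (hq1 : ∀ j p, IsProbabilityMeasure ((volume : Measure ℝ).withDensity (q j p)))
    {f : (j : Fin k) → (Fin (j : ℕ) → ℝ) → ℝ → ℝ}
    (hf : ∀ j, Measurable (Function.uncurry (f j))) {C : ℝ≥0∞} (hC : C ≠ ∞)
    (hfC : ∀ j p, ∫⁻ x, ‖f j p x‖ₑ ∂((volume : Measure ℝ).withDensity (q j p)) ≤ C) :
    ∫⁻ v, ‖∑ j, f j (prevAnswers v j) (v j)‖ₑ ∂(chainMeasure q) ≤ k * C ∧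
      ∀ c : ℝ, (∀ j p, ∫ x, f j p x ∂((volume : Measure ℝ).withDensity (q j p)) ≤ c) →
        ∫ v, ∑ j, f j (prevAnswers v j) (v j) ∂(chainMeasure q) ≤ k * c := by
  induction k with
  | zero => simp
  | succ k ih =>
    have hP : IsProbabilityMeasure (chainMeasure fun j : Fin k => q j.castSucc) :=
      isProbabilityMeasure_chainMeasure (fun j => hq j.castSucc) fun j => hq1 j.castSucc
    have : IsMarkovKernel (lastKernel (q (Fin.last k))) :=
      ⟨fun u => by rw [lastKernel_apply (hq _)]; exact hq1 (Fin.last k) u⟩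
    obtain ⟨ih1, ih2⟩ := ih (fun j => hq j.castSucc) (fun j => hq1 j.castSucc)
      (fun j => hf j.castSucc) (fun j => hfC j.castSucc)
    have hm : Measurable fun v : Fin (k + 1) → ℝ => ∑ j, f j (prevAnswers v j) (v j) :=
      Finset.measurable_sum _ fun j _ => measurable_comp_prevAnswers (hf j)
    set S : (Fin k → ℝ) → ℝ := fun u => ∑ j : Fin k, f j.castSucc (prevAnswers u j) (u j)
      with hS
    have hSm : Measurable S :=
      Finset.measurable_sum _ fun j _ => measurable_comp_prevAnswers (hf j.castSucc)
    have hl : Measurable fun p : (Fin k → ℝ) × ℝ => f (Fin.last k) p.1 p.2 := hf (Fin.last k)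
    have hsplit : ∀ p : (Fin k → ℝ) × ℝ,
        ∑ j, f j (prevAnswers (Fin.snoc p.1 p.2 : Fin (k + 1) → ℝ) j)
          ((Fin.snoc p.1 p.2 : Fin (k + 1) → ℝ) j) = S p.1 + f (Fin.last k) p.1 p.2 := by
      intro p
      rw [Fin.sum_univ_castSucc]
      simp only [prevAnswers_snoc_castSucc, Fin.snoc_castSucc, Fin.snoc_last]
      congr 1
      exact congrArg (fun w => f (Fin.last k) w p.2) (prevAnswers_snoc_last p.1 p.2)
    set ν := (chainMeasure fun j : Fin k => q j.castSucc) ⊗ₘ lastKernel (q (Fin.last k))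
      with hν
    have h1 : ∫⁻ p, ‖S p.1‖ₑ ∂ν ≤ k * C := by
      rw [hν, Measure.lintegral_compProd (f := fun p => ‖S p.1‖ₑ) (hSm.comp measurable_fst).enorm]
      simpa using ih1
    have h2 : ∫⁻ p, ‖f (Fin.last k) p.1 p.2‖ₑ ∂ν ≤ C := by
      rw [hν, Measure.lintegral_compProd hl.enorm]
      refine (lintegral_mono (g := fun _ => C) fun u => ?_).trans (by simp)
      rw [lastKernel_apply (hq _)]
      exact hfC (Fin.last k) u
    have i1 : Integrable (fun p => S p.1) ν :=
      ⟨(hSm.comp measurable_fst).aestronglyMeasurable,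
        h1.trans_lt (ENNReal.mul_lt_top (by simp) hC.lt_top)⟩
    have i2 : Integrable (fun p => f (Fin.last k) p.1 p.2) ν :=
      ⟨hl.aestronglyMeasurable, h2.trans_lt hC.lt_top⟩
    rw [chainMeasure_succ hq]
    constructor
    · rw [lintegral_map hm.enorm measurable_snoc]
      simp_rw [hsplit]
      calc _ ≤ ∫⁻ p, (‖S p.1‖ₑ + ‖f (Fin.last k) p.1 p.2‖ₑ) ∂ν :=
            lintegral_mono fun p => enorm_add_le _ _
        _ = ∫⁻ p, ‖S p.1‖ₑ ∂ν + ∫⁻ p, ‖f (Fin.last k) p.1 p.2‖ₑ ∂ν :=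
            lintegral_add_left (hSm.comp measurable_fst).enorm _
        _ ≤ k * C + C := add_le_add h1 h2
        _ = _ := by push_cast; ring
    · intro c hfc
      rw [integral_map measurable_snoc.aemeasurable hm.aestronglyMeasurable]
      simp_rw [hsplit]
      rw [integral_add i1 i2, hν, Measure.integral_compProd i1, Measure.integral_compProd i2]
      have h3 : ∫ u, ∫ x, f (Fin.last k) u x ∂(lastKernel (q (Fin.last k)) u)
          ∂(chainMeasure fun j : Fin k => q j.castSucc) ≤ c := by
        have : ∫ u, ∫ x, f (Fin.last k) u x ∂(lastKernel (q (Fin.last k)) u)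
          ∂(chainMeasure fun j : Fin k => q j.castSucc) ≤
          ∫ _, c ∂(chainMeasure fun j : Fin k => q j.castSucc) := by
          have hI := Integrable.integral_compProd (κ := Kernel.const Unit
            (chainMeasure fun j : Fin k => q j.castSucc))
            (η := Kernel.prodMkLeft Unit (lastKernel (q (Fin.last k)))) (a := ()) i2
          refine integral_mono hI (integrable_const _) fun u => ?_
          rw [lastKernel_apply (hq _)]
          exact hfc (Fin.last k) u
        simpa using this
      have h4 : ∫ u, ∫ _, S u ∂(lastKernel (q (Fin.last k)) u)
          ∂(chainMeasure fun j : Fin k => q j.castSucc) ≤ k * c := by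
        simpa using ih2 c fun j => hfc j.castSucc
      push_cast
      linarith

lemma measurable_empMean {X : Type*} {m : ℕ} (s : Fin m → X) :
    Measurable fun ψ : X → ℝ => empMean ψ s := by
  unfold empMean
  fun_prop

lemma measurable_empVar {X : Type*} {m : ℕ} (s : Fin m → X) :
    Measurable fun ψ : X → ℝ => empVar ψ s := by
  have := measurable_empMean s
  unfold empVar
  fun_prop

lemma measurable_noiseVar {X : Type*} {m : ℕ} (t T : ℝ) (s : Fin m → X) :
    Measurable fun ψ : X → ℝ => noiseVar t T ψ s :=
  ((measurable_empVar s).div_const _).max measurable_const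

/-- The density at `x` of the answer to the query `ψ` on the dataset `s`. -/
noncomputable def answerDensity {X : Type*} {m : ℕ} (t T : ℝ) (s : Fin m → X) (ψ : X → ℝ)
    (x : ℝ) : ℝ :=
  gpdf (empMean ψ s) (noiseVar t T ψ s) x

lemma answerDensity_pos {X : Type*} {m : ℕ} {t T : ℝ} (hT : 0 < T) (s : Fin m → X) (ψ : X → ℝ)
    (x : ℝ) : 0 < answerDensity t T s ψ x :=
  gpdf_pos (noiseVar_pos hT ψ s) _ x

lemma measurable_answerDensity {X : Type*} {m : ℕ} (t T : ℝ) (s : Fin m → X) :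
    Measurable (Function.uncurry (answerDensity t T s)) := by
  have h1 : Measurable fun p : (X → ℝ) × ℝ => empMean p.1 s :=
    (measurable_empMean s).comp measurable_fst
  have h2 : Measurable fun p : (X → ℝ) × ℝ => noiseVar t T p.1 s :=
    (measurable_noiseVar t T s).comp measurable_fst
  unfold Function.uncurry answerDensity gpdf
  fun_prop

lemma withDensity_answerDensity {X : Type*} {m : ℕ} {t T : ℝ} (hT : 0 < T) (s : Fin m → X)
    (ψ : X → ℝ) :
    (volume : Measure ℝ).withDensity (fun x => ENNReal.ofReal (answerDensity t T s ψ x)) =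
      gaussianReal (empMean ψ s) (noiseVar t T ψ s).toNNReal :=
  withDensity_gpdf (noiseVar_pos hT ψ s) _

lemma isProbabilityMeasure_withDensity_answerDensity {X : Type*} {m : ℕ} {t T : ℝ}
    (hT : 0 < T) (s : Fin m → X) (ψ : X → ℝ) :
    IsProbabilityMeasure ((volume : Measure ℝ).withDensity
      fun x => ENNReal.ofReal (answerDensity t T s ψ x)) := by
  rw [withDensity_answerDensity hT]
  infer_instance

/-- The density of a transcript with respect to the law of the transcript under Lebesgue-distributed
answers. -/
noncomputable def transcriptDensity {X : Type*} {k m : ℕ} (t T : ℝ) (s : Fin m → X)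
    (z : (Fin k → (X → ℝ)) × (Fin k → ℝ)) : ℝ :=
  ∏ j, answerDensity t T s (z.1 j) (z.2 j)

lemma transcriptDensity_pos {X : Type*} {k m : ℕ} {t T : ℝ} (hT : 0 < T) (s : Fin m → X)
    (z : (Fin k → (X → ℝ)) × (Fin k → ℝ)) : 0 < transcriptDensity t T s z :=
  Finset.prod_pos fun _ _ => answerDensity_pos hT s _ _

lemma measurable_eval_pair {X : Type*} {k : ℕ} {β : Type*} [MeasurableSpace β]
    {f : (X → ℝ) → ℝ → β} (hf : Measurable (Function.uncurry f)) (j : Fin k) :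
    Measurable fun z : (Fin k → (X → ℝ)) × (Fin k → ℝ) => f (z.1 j) (z.2 j) := by
  have h : Measurable fun z : (Fin k → (X → ℝ)) × (Fin k → ℝ) => (z.1 j, z.2 j) := by fun_prop
  exact hf.comp h

lemma measurable_transcriptDensity {X : Type*} {k m : ℕ} (t T : ℝ) (s : Fin m → X) :
    Measurable (transcriptDensity (k := k) t T s) :=
  Finset.measurable_prod _ fun j _ => measurable_eval_pair (measurable_answerDensity t T s) j

/-- The transcript produced by the answers `v` when the adversary has seed `ω`. -/
def toTranscript {X Ω : Type*} {k : ℕ} (A : Ω → (j : Fin k) → (Fin (j : ℕ) → ℝ) → X → ℝ)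
    (p : Ω × (Fin k → ℝ)) : (Fin k → (X → ℝ)) × (Fin k → ℝ) :=
  (fun j => A p.1 j (prevAnswers p.2 j), p.2)

lemma ansM_eq_chainMeasure {X Ω : Type*} {k m : ℕ} (t T : ℝ)
    (A : Ω → (j : Fin k) → (Fin (j : ℕ) → ℝ) → X → ℝ) (ω : Ω) (s : Fin m → X) :
    ansM t T A ω s =
      chainMeasure fun j p x => ENNReal.ofReal (answerDensity t T s (A ω j p) x) := rfl

section Transcript

variable {X Ω : Type*} [MeasurableSpace Ω] {k m : ℕ} {t T : ℝ}
  {A : Ω → (j : Fin k) → (Fin (j : ℕ) → ℝ) → X → ℝ}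

lemma measurable_toTranscript
    (hAmeas : ∀ j : Fin k, Measurable fun pr : Ω × (Fin (j : ℕ) → ℝ) => A pr.1 j pr.2) :
    Measurable (toTranscript A) :=
  (measurable_pi_lambda _ fun j => (hAmeas j).comp
    (measurable_fst.prodMk ((measurable_prevAnswers j).comp measurable_snd))).prodMk
    measurable_snd

/-- The law of the answers as a kernel in the seed of the adversary. -/
noncomputable def answerKernel (t T : ℝ) (A : Ω → (j : Fin k) → (Fin (j : ℕ) → ℝ) → X → ℝ)
    (s : Fin m → X) : Kernel Ω (Fin k → ℝ) :=
  Kernel.withDensity (Kernel.const _ (Measure.pi fun _ : Fin k => (volume : Measure ℝ)))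
    fun ω v => ENNReal.ofReal (transcriptDensity t T s (toTranscript A (ω, v)))

lemma measurable_ofReal_transcriptDensity
    (hAmeas : ∀ j : Fin k, Measurable fun pr : Ω × (Fin (j : ℕ) → ℝ) => A pr.1 j pr.2)
    (s : Fin m → X) :
    Measurable (Function.uncurry fun (ω : Ω) (v : Fin k → ℝ) =>
      ENNReal.ofReal (transcriptDensity t T s (toTranscript A (ω, v)))) :=
  ((measurable_transcriptDensity t T s).comp (measurable_toTranscript hAmeas)).ennreal_ofReal

lemma answerKernel_apply (hT : 0 < T)
    (hAmeas : ∀ j : Fin k, Measurable fun pr : Ω × (Fin (j : ℕ) → ℝ) => A pr.1 j pr.2)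
    (s : Fin m → X) (ω : Ω) : answerKernel t T A s ω = ansM t T A ω s := by
  rw [answerKernel, Kernel.withDensity_apply _ (measurable_ofReal_transcriptDensity hAmeas s),
    Kernel.const_apply, ansM]
  congr 1
  ext v
  rw [transcriptDensity, ENNReal.ofReal_prod_of_nonneg fun _ _ => (answerDensity_pos hT s _ _).le]
  rfl

lemma measurable_query
    (hAmeas : ∀ j : Fin k, Measurable fun pr : Ω × (Fin (j : ℕ) → ℝ) => A pr.1 j pr.2)
    {β : Type*} [MeasurableSpace β] {f : (X → ℝ) → ℝ → β}
    (hf : Measurable (Function.uncurry f)) (ω : Ω) (j : Fin k) :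
    Measurable (Function.uncurry fun p x => f (A ω j p) x) :=
  hf.comp ((((hAmeas j).comp measurable_prodMk_left).comp measurable_fst).prodMk measurable_snd)

lemma isMarkovKernel_answerKernel (hT : 0 < T)
    (hAmeas : ∀ j : Fin k, Measurable fun pr : Ω × (Fin (j : ℕ) → ℝ) => A pr.1 j pr.2)
    (s : Fin m → X) : IsMarkovKernel (answerKernel t T A s) := by
  refine ⟨fun ω => ?_⟩
  rw [answerKernel_apply hT hAmeas, ansM_eq_chainMeasure]
  exact isProbabilityMeasure_chainMeasure
    (fun j => (measurable_query hAmeas (measurable_answerDensity t T s) ω j).ennreal_ofReal)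
    (fun _ _ => isProbabilityMeasure_withDensity_answerDensity hT s _)

lemma transcript_eq_map (hT : 0 < T) (ρ : Measure Ω) [IsProbabilityMeasure ρ]
    (hAmeas : ∀ j : Fin k, Measurable fun pr : Ω × (Fin (j : ℕ) → ℝ) => A pr.1 j pr.2)
    (s : Fin m → X) :
    transcript t T ρ A s = (ρ ⊗ₘ answerKernel t T A s).map (toTranscript A) := by
  have := isMarkovKernel_answerKernel (t := t) hT hAmeas s
  have hΦ := measurable_toTranscript hAmeas
  have hΦω : ∀ ω, Measurable fun v => toTranscript A (ω, v) := fun ω =>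
    hΦ.comp measurable_prodMk_left
  have htr : transcript t T ρ A s =
      ρ.bind fun ω => (answerKernel t T A s ω).map fun v => toTranscript A (ω, v) := by
    simp_rw [answerKernel_apply hT hAmeas]
    rfl
  have hmeas : Measurable fun ω =>
      (answerKernel t T A s ω).map fun v => toTranscript A (ω, v) := by
    refine Measure.measurable_of_measurable_coe _ fun S hS => ?_
    simp_rw [fun ω => Measure.map_apply (μ := answerKernel t T A s ω) (hΦω ω) hS]
    exact Kernel.measurable_kernel_prodMk_left (κ := answerKernel t T A s) (hΦ hS)
  ext S hS
  rw [htr, Measure.bind_apply hS hmeas.aemeasurable, Measure.map_apply hΦ hS,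
    Measure.compProd_apply (hΦ hS)]
  refine lintegral_congr fun ω => ?_
  rw [Measure.map_apply (hΦω ω) hS]
  rfl

lemma isProbabilityMeasure_transcript (hT : 0 < T) (ρ : Measure Ω) [IsProbabilityMeasure ρ]
    (hAmeas : ∀ j : Fin k, Measurable fun pr : Ω × (Fin (j : ℕ) → ℝ) => A pr.1 j pr.2)
    (s : Fin m → X) : IsProbabilityMeasure (transcript t T ρ A s) := by
  have := isMarkovKernel_answerKernel (t := t) hT hAmeas s
  rw [transcript_eq_map hT ρ hAmeas]
  exact Measure.isProbabilityMeasure_map (measurable_toTranscript hAmeas).aemeasurable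

lemma lintegral_transcript (hT : 0 < T) (ρ : Measure Ω) [IsProbabilityMeasure ρ]
    (hAmeas : ∀ j : Fin k, Measurable fun pr : Ω × (Fin (j : ℕ) → ℝ) => A pr.1 j pr.2)
    (s : Fin m → X) {G : (Fin k → (X → ℝ)) × (Fin k → ℝ) → ℝ≥0∞} (hG : Measurable G) :
    ∫⁻ z, G z ∂(transcript t T ρ A s) =
      ∫⁻ ω, ∫⁻ v, ENNReal.ofReal (transcriptDensity t T s (toTranscript A (ω, v))) *
        G (toTranscript A (ω, v)) ∂(Measure.pi fun _ : Fin k => (volume : Measure ℝ)) ∂ρ := by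
  have := isMarkovKernel_answerKernel (t := t) hT hAmeas s
  have hΦ := measurable_toTranscript hAmeas
  rw [transcript_eq_map hT ρ hAmeas, lintegral_map hG hΦ,
    Measure.lintegral_compProd (f := fun p => G (toTranscript A p)) (hG.comp hΦ)]
  refine lintegral_congr fun ω => ?_
  rw [answerKernel, Kernel.lintegral_withDensity _
    (measurable_ofReal_transcriptDensity hAmeas s) ω
    (g := fun v => G (toTranscript A (ω, v))) ((hG.comp hΦ).comp measurable_prodMk_left),
    Kernel.const_apply]

lemma transcript_eq_withDensity (hT : 0 < T) (ρ : Measure Ω) [IsProbabilityMeasure ρ]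
    (hAmeas : ∀ j : Fin k, Measurable fun pr : Ω × (Fin (j : ℕ) → ℝ) => A pr.1 j pr.2)
    (s : Fin m → X) {m' : ℕ} (s' : Fin m' → X) :
    transcript t T ρ A s = (transcript t T ρ A s').withDensity fun z =>
      ENNReal.ofReal (transcriptDensity t T s z / transcriptDensity t T s' z) := by
  have hr : Measurable fun z : (Fin k → (X → ℝ)) × (Fin k → ℝ) =>
      ENNReal.ofReal (transcriptDensity t T s z / transcriptDensity t T s' z) :=
    ((measurable_transcriptDensity t T s).div (measurable_transcriptDensity t T s')).ennreal_ofReal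
  refine Measure.ext_of_lintegral _ fun G hG => ?_
  rw [lintegral_withDensity_eq_lintegral_mul _ hr hG, lintegral_transcript hT ρ hAmeas s hG,
    lintegral_transcript hT ρ hAmeas s' (hr.mul hG)]
  refine lintegral_congr fun ω => lintegral_congr fun v => ?_
  have hp := transcriptDensity_pos (t := t) hT s' (toTranscript A (ω, v))
  rw [Pi.mul_apply, ← mul_assoc, ← ENNReal.ofReal_mul hp.le, mul_div_cancel₀ _ hp.ne']

lemma klDiv_transcript (hT : 0 < T) (ρ : Measure Ω) [IsProbabilityMeasure ρ]
    (hAmeas : ∀ j : Fin k, Measurable fun pr : Ω × (Fin (j : ℕ) → ℝ) => A pr.1 j pr.2)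
    (s : Fin m → X) {m' : ℕ} (s' : Fin m' → X) :
    klDiv (transcript t T ρ A s) (transcript t T ρ A s') =
      ∫ z, ∑ j, Real.log (answerDensity t T s (z.1 j) (z.2 j) /
        answerDensity t T s' (z.1 j) (z.2 j)) ∂(transcript t T ρ A s) := by
  have hP := transcript_eq_withDensity (t := t) hT ρ hAmeas s s'
  have := isProbabilityMeasure_transcript (t := t) hT ρ hAmeas s'
  have hr : Measurable fun z : (Fin k → (X → ℝ)) × (Fin k → ℝ) =>
      ENNReal.ofReal (transcriptDensity t T s z / transcriptDensity t T s' z) :=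
    ((measurable_transcriptDensity t T s).div (measurable_transcriptDensity t T s')).ennreal_ofReal
  have hac : transcript t T ρ A s ≪ transcript t T ρ A s' := by
    rw [hP]; exact withDensity_absolutelyContinuous _ _
  have hrn := Measure.rnDeriv_withDensity (transcript t T ρ A s') hr
  rw [← hP] at hrn
  refine integral_congr_ae ?_
  filter_upwards [hac.ae_le hrn] with z hz
  have hp := transcriptDensity_pos (t := t) hT s z
  have hp' := transcriptDensity_pos (t := t) hT s' z
  rw [llr, hz, ENNReal.toReal_ofReal (by positivity), transcriptDensity, transcriptDensity,
    ← Finset.prod_div_distrib, Real.log_prod]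
  exact fun j _ => (div_pos (answerDensity_pos hT s _ _) (answerDensity_pos hT s' _ _)).ne'

lemma transcript_sum_bounds (hT : 0 < T) (ρ : Measure Ω) [IsProbabilityMeasure ρ]
    (hA : ∀ ω j pa x, A ω j pa x ∈ Set.Icc (0 : ℝ) 1)
    (hAmeas : ∀ j : Fin k, Measurable fun pr : Ω × (Fin (j : ℕ) → ℝ) => A pr.1 j pr.2)
    (s : Fin m → X) {f : (X → ℝ) → ℝ → ℝ} (hf : Measurable (Function.uncurry f)) {C : ℝ≥0∞}
    (hC : C ≠ ∞)
    (hfC : ∀ ψ : X → ℝ, (∀ x, ψ x ∈ Set.Icc (0 : ℝ) 1) →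
      ∫⁻ x, ‖f ψ x‖ₑ ∂(gaussianReal (empMean ψ s) (noiseVar t T ψ s).toNNReal) ≤ C) :
    Integrable (fun z : (Fin k → (X → ℝ)) × (Fin k → ℝ) => ∑ j, f (z.1 j) (z.2 j))
      (transcript t T ρ A s) ∧
    ∀ c : ℝ, (∀ ψ : X → ℝ, (∀ x, ψ x ∈ Set.Icc (0 : ℝ) 1) →
      ∫ x, f ψ x ∂(gaussianReal (empMean ψ s) (noiseVar t T ψ s).toNNReal) ≤ c) →
      ∫ z, ∑ j, f (z.1 j) (z.2 j) ∂(transcript t T ρ A s) ≤ k * c := by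
  have := isMarkovKernel_answerKernel (t := t) hT hAmeas s
  have hΦ := measurable_toTranscript hAmeas
  have hF : Measurable fun z : (Fin k → (X → ℝ)) × (Fin k → ℝ) => ∑ j, f (z.1 j) (z.2 j) :=
    Finset.measurable_sum _ fun j _ => measurable_eval_pair hf j
  have key := fun ω => chainMeasure_sum_bounds
    (q := fun j p x => ENNReal.ofReal (answerDensity t T s (A ω j p) x))
    (fun j => (measurable_query hAmeas (measurable_answerDensity t T s) ω j).ennreal_ofReal)
    (fun _ _ => isProbabilityMeasure_withDensity_answerDensity hT s _)
    (f := fun j p x => f (A ω j p) x) (measurable_query hAmeas hf ω) hC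
    (fun j p => by rw [withDensity_answerDensity hT]; exact hfC _ (hA ω j p))
  have hint : Integrable (fun p => ∑ j, f ((toTranscript A p).1 j) ((toTranscript A p).2 j))
      (ρ ⊗ₘ answerKernel t T A s) := by
    refine ⟨(hF.comp hΦ).aestronglyMeasurable, ?_⟩
    rw [HasFiniteIntegral, Measure.lintegral_compProd
      (f := fun p => ‖∑ j, f ((toTranscript A p).1 j) ((toTranscript A p).2 j)‖ₑ)
      (hF.comp hΦ).enorm]
    refine (lintegral_mono (g := fun _ => k * C) fun ω => ?_).trans_lt ?_
    · rw [answerKernel_apply hT hAmeas, ansM_eq_chainMeasure]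
      exact (key ω).1
    · simpa using ENNReal.mul_lt_top (by simp) hC.lt_top
  rw [transcript_eq_map hT ρ hAmeas]
  refine ⟨(integrable_map_measure hF.aestronglyMeasurable hΦ.aemeasurable).2 hint,
    fun c hc => ?_⟩
  rw [integral_map hΦ.aemeasurable hF.aestronglyMeasurable, Measure.integral_compProd hint]
  have hI := Integrable.integral_compProd (κ := Kernel.const Unit ρ)
    (η := Kernel.prodMkLeft Unit (answerKernel t T A s)) (a := ()) hint
  refine (integral_mono (g := fun _ => k * c) hI (integrable_const _) fun ω => ?_).trans_eq
    (by simp)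
  change ∫ v, _ ∂(answerKernel t T A s ω) ≤ _
  rw [answerKernel_apply hT hAmeas, ansM_eq_chainMeasure]
  refine (key ω).2 c fun j p => ?_
  rw [withDensity_answerDensity hT]
  exact hc _ (hA ω j p)

end Transcript

/-- **ALKL stability of the variance-calibrated Gaussian mechanism (Theorem 4.1).**
Fix dataset size `n + 1 ≥ 20` and `k ≥ 20` adaptively chosen statistical queries
`ψ_j : X → [0,1]`, and parameters `t, T > 0` with `T ≤ min{t², t(n+1)/10}`.  For every
randomized interactive adversary (seed distribution `ρ`, next-query function `A`, with
queries taking values in `[0,1]`), the map taking the dataset `s` to the transcript of the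
interaction is `(kt/(n+1)²)`-ALKL stable:
`(1/(n+1)) Σ_i D_KL(Transcript(s) ‖ Transcript(s_{-i})) ≤ kt/(n+1)²`. -/
theorem mechanism_transcript_alkl_stable {X Ω : Type*} [MeasurableSpace Ω] {k n : ℕ}
    (hn : 20 ≤ n + 1) (hk : 20 ≤ k)
    (t T : ℝ) (ht : 0 < t) (hT : 0 < T)
    (hTle : T ≤ min (t ^ 2) (t * (n + 1) / 10))
    (ρ : Measure Ω) [IsProbabilityMeasure ρ]
    (A : Ω → (j : Fin k) → (Fin (j : ℕ) → ℝ) → X → ℝ)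
    (hA : ∀ ω j pa x, A ω j pa x ∈ Set.Icc (0 : ℝ) 1)
    (hAmeas : ∀ j : Fin k, Measurable fun pr : Ω × (Fin (j : ℕ) → ℝ) => A pr.1 j pr.2) :
    ∀ s : Fin (n + 1) → X,
      (1 / ((n : ℝ) + 1)) * ∑ i : Fin (n + 1),
          klDiv (transcript t T ρ A s) (transcript t T ρ A (i.removeNth s)) ≤
        k * t / ((n : ℝ) + 1) ^ 2 := by
  intro s
  have hTt : T ≤ t ^ 2 := hTle.trans (min_le_left _ _)
  have hTn : T ≤ t * (n + 1) / 10 := hTle.trans (min_le_right _ _)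
  set f : Fin (n + 1) → (X → ℝ) → ℝ → ℝ := fun i ψ x =>
    Real.log (answerDensity t T s ψ x / answerDensity t T (i.removeNth s) ψ x)
  have hfm : ∀ i, Measurable (Function.uncurry (f i)) := fun i =>
    ((measurable_answerDensity t T s).div (measurable_answerDensity t T (i.removeNth s))).log
  have hvar : ∀ {m : ℕ} (s' : Fin m → X) (ψ : X → ℝ), (∀ x, ψ x ∈ Set.Icc (0 : ℝ) 1) →
      noiseVar t T ψ s' ∈ Set.Icc (1 / T) (1 / t + 1 / T) := by
    intro m s' ψ hψ
    refine ⟨le_max_right _ _, max_le ?_ ?_⟩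
    · have : empVar ψ s' / t ≤ 1 / t := by
        have := empVar_le_one hψ s'
        gcongr
      have : 0 < 1 / T := by positivity
      linarith
    · have : 0 < 1 / t := by positivity
      linarith
  set C := ENNReal.ofReal (3 * ((1 / t + 1 / T) + 1) / (1 / T))
  have hfC : ∀ i, ∀ ψ : X → ℝ, (∀ x, ψ x ∈ Set.Icc (0 : ℝ) 1) →
      ∫⁻ x, ‖f i ψ x‖ₑ ∂(gaussianReal (empMean ψ s) (noiseVar t T ψ s).toNNReal) ≤ C :=
    fun i ψ hψ => lintegral_enorm_log_gpdf_div_le (empMean_mem_Icc hψ s)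
      (empMean_mem_Icc hψ _) (by positivity) (hvar s ψ hψ) (hvar _ ψ hψ)
  have hint := fun i =>
    (transcript_sum_bounds (t := t) hT ρ hA hAmeas s (hfm i) ENNReal.ofReal_ne_top (hfC i)).1
  have hsum := (transcript_sum_bounds (t := t) hT ρ hA hAmeas s (f := fun ψ x => ∑ i, f i ψ x)
    (C := (n + 1) * C) (Finset.measurable_sum _ fun i _ => hfm i)
    (ENNReal.mul_ne_top (by simp) ENNReal.ofReal_ne_top) (fun ψ hψ => by
      refine (lintegral_mono fun x => enorm_sum_le _ _).trans ?_
      have hfe : ∀ i, Measurable fun x => ‖f i ψ x‖ₑ := fun i =>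
        ((hfm i).comp (measurable_prodMk_left (x := ψ))).enorm
      rw [lintegral_finsetSum _ fun i _ => hfe i]
      exact (Finset.sum_le_sum fun i _ => hfC i ψ hψ).trans (by simp))).2 (t / (n + 1))
    (fun ψ hψ => by
      have h := fun i : Fin (n + 1) => integral_log_gpdf_div
        (noiseVar_pos (t := t) hT ψ s) (noiseVar_pos (t := t) hT ψ (i.removeNth s))
        (empMean ψ s) (empMean ψ (i.removeNth s))
      rw [integral_finsetSum (f := fun i x => f i ψ x) _ fun i _ => (h i).1]
      exact (Finset.sum_congr rfl fun i _ => (h i).2).trans_le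
        (sum_gaussKL_removeNth_le hn ht hT hTt hTn hψ s))
  have hkl : ∑ i : Fin (n + 1), klDiv (transcript t T ρ A s)
      (transcript t T ρ A (i.removeNth s)) ≤ k * (t / (n + 1)) := by
    simp_rw [klDiv_transcript hT ρ hAmeas s]
    rw [← integral_finsetSum _ fun i _ => hint i]
    refine le_of_eq_of_le (integral_congr_ae (Filter.Eventually.of_forall fun z => ?_)) hsum
    exact Finset.sum_comm
  calc (1 / ((n : ℝ) + 1)) * ∑ i : Fin (n + 1), klDiv (transcript t T ρ A s)
        (transcript t T ρ A (i.removeNth s))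
      ≤ (1 / ((n : ℝ) + 1)) * (k * (t / (n + 1))) := by gcongr
    _ = k * t / ((n : ℝ) + 1) ^ 2 := by field_simp
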